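/- The contravariant metric g on {(u,v,w) ∈ ℝ³ : w ≠ 0} with matrix (g^{ij}) = [[v³/w², −3v²/(2w), −v+1],[−3v²/(2w), 2v+1, w],[−v+1, w, 0]] is flat, and g is compatible with the constant metric η^{ij} = δ_{i+j,4}: for every λ ∈ ℝ, on the open set where g + λη is non-degenerate, the metric g + λη is flat and its contravariant Christoffel symbols coincide with those of g. -/

import Mathlib

open scoped BigOperators

/-- Partial derivative of a function on `ℝⁿ` in the `i`-th coordinate direction. -/
noncomputable def pd {n : ℕ} (i : Fin n) (f : (Fin n → ℝ) → ℝ) (x : Fin n → ℝ) : ℝ :=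
  fderiv ℝ f x (Pi.single i 1)

/-- The covariant metric `g_{ij}`: the pointwise matrix inverse of the contravariant
metric `g^{ij}`. -/
noncomputable def covMetric {n : ℕ} (g : (Fin n → ℝ) → Matrix (Fin n) (Fin n) ℝ)
    (x : Fin n → ℝ) : Matrix (Fin n) (Fin n) ℝ := (g x)⁻¹

/-- The Levi-Civita Christoffel symbols `Γ^i_{jk}` of the covariant metric
`g_{ij} = (g^{ij})⁻¹`, with the upper index raised with `g^{is}`. -/
noncomputable def christoffel {n : ℕ} (g : (Fin n → ℝ) → Matrix (Fin n) (Fin n) ℝ)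
    (i j k : Fin n) (x : Fin n → ℝ) : ℝ :=
  (1 / 2) * ∑ s, g x i s *
    (pd j (fun y => covMetric g y s k) x + pd k (fun y => covMetric g y s j) x
      - pd s (fun y => covMetric g y j k) x)

/-- The Riemann curvature tensor `R^i_{jkl}` of the Levi-Civita connection of `g_{ij}`. -/
noncomputable def riemann {n : ℕ} (g : (Fin n → ℝ) → Matrix (Fin n) (Fin n) ℝ)
    (i j k l : Fin n) (x : Fin n → ℝ) : ℝ :=
  pd k (christoffel g i l j) x - pd l (christoffel g i k j) x
    + ∑ s, (christoffel g i k s x * christoffel g s l j x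
      - christoffel g i l s x * christoffel g s k j x)

/-- The contravariant Christoffel symbols `Γ^{ij}_k = −g^{is} Γ^j_{sk}`. -/
noncomputable def contraChristoffel {n : ℕ} (g : (Fin n → ℝ) → Matrix (Fin n) (Fin n) ℝ)
    (i j k : Fin n) (x : Fin n → ℝ) : ℝ :=
  - ∑ s, g x i s * christoffel g j s k x

/-- The contravariant metric `g` is flat on `U`. -/
def IsFlatOn {n : ℕ} (g : (Fin n → ℝ) → Matrix (Fin n) (Fin n) ℝ)
    (U : Set (Fin n → ℝ)) : Prop :=
  ∀ x ∈ U, ∀ i j k l, riemann g i j k l x = 0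

/-- The Lie derivative `(L_f g)^{ij} = f^k ∂_k g^{ij} − g^{kj} ∂_k f^i − g^{ik} ∂_k f^j`
of the contravariant 2-tensor `g` along the vector field `f`. -/
noncomputable def lieD {n : ℕ} (f : (Fin n → ℝ) → (Fin n → ℝ))
    (g : (Fin n → ℝ) → Matrix (Fin n) (Fin n) ℝ) (i j : Fin n) (x : Fin n → ℝ) : ℝ :=
  ∑ k, (f x k * pd k (fun y => g y i j) x
    - g x k j * pd k (fun y => f y i) x - g x i k * pd k (fun y => f y j) x)

/-- `f` is a Killing vector field (infinitesimal isometry) of `g` on `U`. -/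
def IsKillingOn {n : ℕ} (f : (Fin n → ℝ) → (Fin n → ℝ))
    (g : (Fin n → ℝ) → Matrix (Fin n) (Fin n) ℝ) (U : Set (Fin n → ℝ)) : Prop :=
  ∀ x ∈ U, ∀ i j, lieD f g i j x = 0

/-- `g` is compatible with `h` on `U`: for every `λ`, at every point of `U` where
`g + λ h` is non-degenerate, `g + λ h` is flat and its contravariant Christoffel
symbols coincide with those of `g`. -/
def CompatibleOn {n : ℕ} (g h : (Fin n → ℝ) → Matrix (Fin n) (Fin n) ℝ)
    (U : Set (Fin n → ℝ)) : Prop :=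
  ∀ lam : ℝ, ∀ x ∈ U, (g x + lam • h x).det ≠ 0 →
    (∀ i j k l, riemann (fun y => g y + lam • h y) i j k l x = 0) ∧
    (∀ i j k, contraChristoffel (fun y => g y + lam • h y) i j k x =
      contraChristoffel g i j k x)

/-- The constant contravariant metric `η` on `ℝ²` with matrix `[[0,1],[1,0]]`. -/
def eta2 : Matrix (Fin 2) (Fin 2) ℝ := !![0, 1; 1, 0]

/-- The constant metric `η^{ij} = δ_{i+j,4}` (antidiagonal identity) on `ℝ³`. -/
def eta3 : Matrix (Fin 3) (Fin 3) ℝ := !![0, 0, 1; 0, 1, 0; 1, 0, 0]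

/-- The contravariant metric of the second Hamiltonian structure of the three-component
isometric extension of the WDVV hydrodynamic type system, with `u = x 0`, `v = x 1`,
`w = x 2`. -/
noncomputable def gW : (Fin 3 → ℝ) → Matrix (Fin 3) (Fin 3) ℝ := fun x =>
  !![(x 1) ^ 3 / (x 2) ^ 2, -3 * (x 1) ^ 2 / (2 * x 2), -(x 1) + 1;
     -3 * (x 1) ^ 2 / (2 * x 2), 2 * x 1 + 1, x 2;
     -(x 1) + 1, x 2, 0]

open Filter Topology

theorem pd_congr {n : ℕ} {f g : (Fin n → ℝ) → ℝ} {x : Fin n → ℝ} (h : f =ᶠ[𝓝 x] g)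
    (i : Fin n) : pd i f x = pd i g x := by
  rw [pd, pd, h.fderiv_eq]

/-- Partial derivatives of a function of the last two coordinates on `ℝ³`, in terms of the
one-variable derivatives. -/
theorem pd_of_hasDerivAt {F : ℝ → ℝ → ℝ} {x : Fin 3 → ℝ} {a b : ℝ}
    (hd : DifferentiableAt ℝ (fun y : Fin 3 → ℝ => F (y 1) (y 2)) x)
    (ha : HasDerivAt (fun t => F t (x 2)) a (x 1))
    (hb : HasDerivAt (fun t => F (x 1) t) b (x 2)) (i : Fin 3) :
    pd i (fun y => F (y 1) (y 2)) x = ![0, a, b] i := by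
  have key : pd i (fun y => F (y 1) (y 2)) x =
      deriv (fun t : ℝ => F ((x + t • Pi.single i (1 : ℝ) : Fin 3 → ℝ) 1)
        ((x + t • Pi.single i (1 : ℝ) : Fin 3 → ℝ) 2)) 0 :=
    hd.lineDeriv_eq_fderiv.symm
  rw [key]
  fin_cases i
  · simp
  · have h := HasDerivAt.comp_const_add (x 1) 0 (by simpa using ha)
    simpa using h.deriv
  · have h := HasDerivAt.comp_const_add (x 2) 0 (by simpa using hb)
    simpa using h.deriv

/-- The pencil `g + (μ - 1) η`. -/
noncomputable def pencil (μ : ℝ) (x : Fin 3 → ℝ) : Matrix (Fin 3) (Fin 3) ℝ :=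
  !![(x 1) ^ 3 / (x 2) ^ 2, -3 * (x 1) ^ 2 / (2 * x 2), μ - x 1;
     -3 * (x 1) ^ 2 / (2 * x 2), 2 * x 1 + μ, x 2;
     μ - x 1, x 2, 0]

theorem gW_add_smul_eta3 (lam : ℝ) :
    (fun y => gW y + lam • eta3) = pencil (1 + lam) := by
  funext y
  ext i j
  fin_cases i <;> fin_cases j <;> simp [gW, eta3, pencil] <;> ring

theorem gW_eq_pencil : gW = pencil 1 := by
  simpa using gW_add_smul_eta3 0

theorem det_pencil {μ : ℝ} {x : Fin 3 → ℝ} (hx : x 2 ≠ 0) : (pencil μ x).det = -μ ^ 3 := by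
  simp only [pencil, Matrix.det_fin_three]
  simp
  field_simp
  ring

/-- The inverse of the pencil, as a function of `v` and `w`. -/
noncomputable def pencilInv (μ v w : ℝ) : Matrix (Fin 3) (Fin 3) ℝ :=
  !![w ^ 2 / μ ^ 3, -(μ - v) * w / μ ^ 3, (2 * μ ^ 2 + 2 * μ * v - v ^ 2) / (2 * μ ^ 3);
     -(μ - v) * w / μ ^ 3, (μ - v) ^ 2 / μ ^ 3, v ^ 2 * (3 * μ - v) / (2 * μ ^ 3) / w;
     (2 * μ ^ 2 + 2 * μ * v - v ^ 2) / (2 * μ ^ 3), v ^ 2 * (3 * μ - v) / (2 * μ ^ 3) / w,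
       v ^ 3 * (v - 4 * μ) / (4 * μ ^ 3) / w ^ 2]

theorem covMetric_pencil {μ : ℝ} (hμ : μ ≠ 0) {x : Fin 3 → ℝ} (hx : x 2 ≠ 0) :
    covMetric (pencil μ) x = pencilInv μ (x 1) (x 2) := by
  apply Matrix.inv_eq_right_inv
  ext i j
  fin_cases i <;> fin_cases j <;>
    simp [pencil, pencilInv, Matrix.mul_apply, Fin.sum_univ_three] <;> field_simp <;> ring

/-- The partial derivative of `pencilInv` in `v`. -/
noncomputable def pencilInvDv (μ v w : ℝ) : Matrix (Fin 3) (Fin 3) ℝ :=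
  !![0, w / μ ^ 3, (μ - v) / μ ^ 3;
     w / μ ^ 3, -2 * (μ - v) / μ ^ 3, (6 * μ * v - 3 * v ^ 2) / (2 * μ ^ 3) / w;
     (μ - v) / μ ^ 3, (6 * μ * v - 3 * v ^ 2) / (2 * μ ^ 3) / w,
       (v ^ 3 - 3 * μ * v ^ 2) / μ ^ 3 / w ^ 2]

/-- The partial derivative of `pencilInv` in `w`. -/
noncomputable def pencilInvDw (μ v w : ℝ) : Matrix (Fin 3) (Fin 3) ℝ :=
  !![2 * w / μ ^ 3, -(μ - v) / μ ^ 3, 0;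
     -(μ - v) / μ ^ 3, 0, -(v ^ 2 * (3 * μ - v)) / (2 * μ ^ 3) / w ^ 2;
     0, -(v ^ 2 * (3 * μ - v)) / (2 * μ ^ 3) / w ^ 2,
       -(v ^ 3 * (v - 4 * μ)) / (2 * μ ^ 3) / w ^ 3]

theorem hasDerivAt_of_deriv_eq {f : ℝ → ℝ} {a t : ℝ} (hf : DifferentiableAt ℝ f t)
    (h : deriv f t = a) : HasDerivAt f a t :=
  h ▸ hf.hasDerivAt

theorem differentiableAt_pencilInv {μ : ℝ} {x : Fin 3 → ℝ} (hx : x 2 ≠ 0) (i j : Fin 3) :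
    DifferentiableAt ℝ (fun y : Fin 3 → ℝ => pencilInv μ (y 1) (y 2) i j) x := by
  have h2 : x 2 ^ 2 ≠ 0 := pow_ne_zero 2 hx
  fin_cases i <;> fin_cases j <;> simp [pencilInv] <;> fun_prop (disch := assumption)

theorem hasDerivAt_pencilInv_left (μ v w : ℝ) (i j : Fin 3) :
    HasDerivAt (fun t => pencilInv μ t w i j) (pencilInvDv μ v w i j) v := by
  fin_cases i <;> fin_cases j <;> simp [pencilInv, pencilInvDv] <;>
    apply hasDerivAt_of_deriv_eq (by fun_prop) <;>
    simp (disch := fun_prop) [deriv_fun_mul] <;> ring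

theorem hasDerivAt_pencilInv_right (μ v : ℝ) {w : ℝ} (hw : w ≠ 0) (i j : Fin 3) :
    HasDerivAt (fun t => pencilInv μ v t i j) (pencilInvDw μ v w i j) w := by
  have hw2 : w ^ 2 ≠ 0 := pow_ne_zero 2 hw
  fin_cases i <;> fin_cases j <;> simp [pencilInv, pencilInvDw] <;>
    apply hasDerivAt_of_deriv_eq (by fun_prop (disch := assumption)) <;>
    simp (disch := first | assumption | fun_prop (disch := assumption))
      [deriv_fun_mul, deriv_fun_div] <;> field_simp <;> ring

theorem eventually_coord_two_ne_zero {x : Fin 3 → ℝ} (hx : x 2 ≠ 0) :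
    ∀ᶠ y in 𝓝 x, y 2 ≠ 0 :=
  (continuous_apply 2).continuousAt.eventually_ne hx

theorem pd_covMetric_pencil {μ : ℝ} (hμ : μ ≠ 0) {x : Fin 3 → ℝ} (hx : x 2 ≠ 0)
    (i j k : Fin 3) :
    pd k (fun y => covMetric (pencil μ) y i j) x =
      ![0, pencilInvDv μ (x 1) (x 2) i j, pencilInvDw μ (x 1) (x 2) i j] k := by
  rw [pd_congr (g := fun y => pencilInv μ (y 1) (y 2) i j)]
  · exact pd_of_hasDerivAt (F := fun v w => pencilInv μ v w i j)
      (differentiableAt_pencilInv hx i j) (hasDerivAt_pencilInv_left _ _ _ i j)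
      (hasDerivAt_pencilInv_right _ _ hx i j) k
  · filter_upwards [eventually_coord_two_ne_zero hx] with y hy
    rw [covMetric_pencil hμ hy]

/-- The Christoffel symbols `Γ^0_{jk}` of the pencil, as functions of `v` and `w`. -/
noncomputable def pencilGammaZero (μ v w : ℝ) : Matrix (Fin 3) (Fin 3) ℝ :=
  !![-(μ - v) * w / μ ^ 3, (μ - v) ^ 2 / μ ^ 3, v ^ 2 * (3 * μ - v) / (2 * μ ^ 3) / w;
     (μ - v) ^ 2 / μ ^ 3, v * (3 * μ ^ 2 - 3 * μ * v + v ^ 2) / μ ^ 3 / w,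
       -(v ^ 2 * (3 * μ ^ 2 - 4 * μ * v + v ^ 2)) / (2 * μ ^ 3) / w ^ 2;
     v ^ 2 * (3 * μ - v) / (2 * μ ^ 3) / w,
       -(v ^ 2 * (3 * μ ^ 2 - 4 * μ * v + v ^ 2)) / (2 * μ ^ 3) / w ^ 2,
       v ^ 3 * (4 * μ ^ 2 - 5 * μ * v + v ^ 2) / (4 * μ ^ 3) / w ^ 3]

/-- The partial derivative of `pencilGammaZero` in `v`. -/
noncomputable def pencilGammaZeroDv (μ v w : ℝ) : Matrix (Fin 3) (Fin 3) ℝ :=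
  !![w / μ ^ 3, -2 * (μ - v) / μ ^ 3, (6 * μ * v - 3 * v ^ 2) / (2 * μ ^ 3) / w;
     -2 * (μ - v) / μ ^ 3, 3 * (μ - v) ^ 2 / μ ^ 3 / w,
       -(3 * μ ^ 2 * v - 6 * μ * v ^ 2 + 2 * v ^ 3) / μ ^ 3 / w ^ 2;
     (6 * μ * v - 3 * v ^ 2) / (2 * μ ^ 3) / w,
       -(3 * μ ^ 2 * v - 6 * μ * v ^ 2 + 2 * v ^ 3) / μ ^ 3 / w ^ 2,
       (12 * μ ^ 2 * v ^ 2 - 20 * μ * v ^ 3 + 5 * v ^ 4) / (4 * μ ^ 3) / w ^ 3]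

/-- The partial derivative of `pencilGammaZero` in `w`. -/
noncomputable def pencilGammaZeroDw (μ v w : ℝ) : Matrix (Fin 3) (Fin 3) ℝ :=
  !![-(μ - v) / μ ^ 3, 0, -(v ^ 2 * (3 * μ - v)) / (2 * μ ^ 3) / w ^ 2;
     0, -(v * (3 * μ ^ 2 - 3 * μ * v + v ^ 2)) / μ ^ 3 / w ^ 2,
       v ^ 2 * (3 * μ ^ 2 - 4 * μ * v + v ^ 2) / μ ^ 3 / w ^ 3;
     -(v ^ 2 * (3 * μ - v)) / (2 * μ ^ 3) / w ^ 2,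
       v ^ 2 * (3 * μ ^ 2 - 4 * μ * v + v ^ 2) / μ ^ 3 / w ^ 3,
       -3 * (v ^ 3 * (4 * μ ^ 2 - 5 * μ * v + v ^ 2)) / (4 * μ ^ 3) / w ^ 4]

theorem differentiableAt_pencilGammaZero {μ : ℝ} {x : Fin 3 → ℝ} (hx : x 2 ≠ 0)
    (i j : Fin 3) :
    DifferentiableAt ℝ (fun y : Fin 3 → ℝ => pencilGammaZero μ (y 1) (y 2) i j) x := by
  have h2 : x 2 ^ 2 ≠ 0 := pow_ne_zero 2 hx
  have h3 : x 2 ^ 3 ≠ 0 := pow_ne_zero 3 hx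
  fin_cases i <;> fin_cases j <;> simp [pencilGammaZero] <;> fun_prop (disch := assumption)

theorem hasDerivAt_pencilGammaZero_left (μ v w : ℝ) (i j : Fin 3) :
    HasDerivAt (fun t => pencilGammaZero μ t w i j) (pencilGammaZeroDv μ v w i j) v := by
  fin_cases i <;> fin_cases j <;> simp [pencilGammaZero, pencilGammaZeroDv] <;>
    apply hasDerivAt_of_deriv_eq (by fun_prop) <;>
    simp (disch := fun_prop) [deriv_fun_mul] <;> ring

theorem hasDerivAt_pencilGammaZero_right (μ v : ℝ) {w : ℝ} (hw : w ≠ 0) (i j : Fin 3) :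
    HasDerivAt (fun t => pencilGammaZero μ v t i j) (pencilGammaZeroDw μ v w i j) w := by
  have hw2 : w ^ 2 ≠ 0 := pow_ne_zero 2 hw
  have hw3 : w ^ 3 ≠ 0 := pow_ne_zero 3 hw
  fin_cases i <;> fin_cases j <;> simp [pencilGammaZero, pencilGammaZeroDw] <;>
    apply hasDerivAt_of_deriv_eq (by fun_prop (disch := assumption)) <;>
    simp (disch := first | assumption | fun_prop (disch := assumption))
      [deriv_fun_mul, deriv_fun_div] <;> field_simp

theorem christoffel_pencil {μ : ℝ} (hμ : μ ≠ 0) {x : Fin 3 → ℝ} (hx : x 2 ≠ 0)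
    (i j k : Fin 3) :
    christoffel (pencil μ) i j k x =
      ![pencilGammaZero μ (x 1) (x 2) j k, -pencilInv μ (x 1) (x 2) j k, 0] i := by
  simp only [christoffel, pd_covMetric_pencil hμ hx, Fin.sum_univ_three]
  fin_cases i <;> fin_cases j <;> fin_cases k <;>
    simp [pencil, pencilInv, pencilInvDv, pencilInvDw, pencilGammaZero] <;>
    first | (right; ring) | (field_simp <;> ring)

theorem pd_christoffel_pencil {μ : ℝ} (hμ : μ ≠ 0) {x : Fin 3 → ℝ} (hx : x 2 ≠ 0)
    (i j k l : Fin 3) :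
    pd l (christoffel (pencil μ) i j k) x =
      ![![0, pencilGammaZeroDv μ (x 1) (x 2) j k, pencilGammaZeroDw μ (x 1) (x 2) j k] l,
        ![0, -pencilInvDv μ (x 1) (x 2) j k, -pencilInvDw μ (x 1) (x 2) j k] l,
        0] i := by
  rw [pd_congr (g := fun y =>
    ![pencilGammaZero μ (y 1) (y 2) j k, -pencilInv μ (y 1) (y 2) j k, 0] i)]
  · fin_cases i
    · exact pd_of_hasDerivAt (F := fun v w => pencilGammaZero μ v w j k)
        (differentiableAt_pencilGammaZero hx j k) (hasDerivAt_pencilGammaZero_left _ _ _ j k)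
        (hasDerivAt_pencilGammaZero_right _ _ hx j k) l
    · exact pd_of_hasDerivAt (F := fun v w => -pencilInv μ v w j k)
        (differentiableAt_pencilInv hx j k).neg (hasDerivAt_pencilInv_left _ _ _ j k).neg
        (hasDerivAt_pencilInv_right _ _ hx j k).neg l
    · simp [pd]
  · filter_upwards [eventually_coord_two_ne_zero hx] with y hy
    rw [christoffel_pencil hμ hy]

theorem riemann_pencil {μ : ℝ} (hμ : μ ≠ 0) {x : Fin 3 → ℝ} (hx : x 2 ≠ 0)
    (i j k l : Fin 3) : riemann (pencil μ) i j k l x = 0 := by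
  simp only [riemann, pd_christoffel_pencil hμ hx, christoffel_pencil hμ hx,
    Fin.sum_univ_three]
  fin_cases i
  · fin_cases j <;> fin_cases k <;> fin_cases l <;>
      simp [pencilInv, pencilGammaZero, pencilGammaZeroDv, pencilGammaZeroDw] <;>
      field_simp <;> ring
  · fin_cases j <;> fin_cases k <;> fin_cases l <;>
      simp [pencilInv, pencilInvDv, pencilInvDw, pencilGammaZero] <;>
      field_simp <;> ring
  · simp

theorem contraChristoffel_pencil {μ : ℝ} (hμ : μ ≠ 0) {x : Fin 3 → ℝ} (hx : x 2 ≠ 0)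
    (i j k : Fin 3) :
    contraChristoffel (pencil μ) i j k x =
      ![!![0, 3 / 2 * x 1 ^ 2 / x 2 ^ 2, -x 1 ^ 3 / x 2 ^ 3; 1, 0, 0; 0, 0, 0],
        !![-1, -3 * x 1 / x 2, 3 / 2 * x 1 ^ 2 / x 2 ^ 2; 0, 1, 0; 0, 0, 0],
        !![0, -1, 0; 0, 0, 1; 0, 0, 0]] i j k := by
  simp only [contraChristoffel, christoffel_pencil hμ hx, Fin.sum_univ_three]
  fin_cases i <;> fin_cases j <;> fin_cases k <;>
    simp [pencil, pencilInv, pencilGammaZero] <;> field_simp <;> ring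

/-- on `{w ≠ 0}` the metric `g` is flat and compatible with `η`. -/
theorem stmt17 :
    IsFlatOn gW {x | x 2 ≠ 0} ∧
    CompatibleOn gW (fun _ => eta3) {x | x 2 ≠ 0} := by
  refine ⟨fun x hx i j k l => ?_, fun lam x hx hdet => ?_⟩
  · rw [gW_eq_pencil]
    exact riemann_pencil one_ne_zero hx i j k l
  · have hx' : x 2 ≠ 0 := hx
    have hμ : 1 + lam ≠ 0 := by
      intro h
      have h' := congrFun (gW_add_smul_eta3 lam) x
      apply hdet
      simp only at h' ⊢
      rw [h', det_pencil hx', h]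
      norm_num
    rw [gW_add_smul_eta3]
    refine ⟨riemann_pencil hμ hx', fun i j k => ?_⟩
    rw [gW_eq_pencil, contraChristoffel_pencil hμ hx', contraChristoffel_pencil one_ne_zero hx']
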